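/- For every 𝐫 = (r_1,r_2,…) ∈ (ℚ∩(0,1))^ℕ, one has χ(π(𝔰(𝐫))) = π(𝔱(𝐫)). -/

import Mathlib

noncomputable section

/-- The doubling map. -/
def Dbl (x : ℝ) : ℝ := if x ≤ 1/2 then 2*x else 2*x - 1

/-- Survivor set `𝒥(a,b)`. -/
def J (a b : ℝ) : Set ℝ := {x ∈ Set.Icc (0:ℝ) 1 | ∀ n : ℕ, Dbl^[n] x ∉ Set.Ioo a b}

/-- The shift on binary sequences. -/
def shft (x : ℕ → Bool) : ℕ → Bool := fun n => x (n+1)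

/-- Binary expansion value. -/
def piMap (w : ℕ → Bool) : ℝ := ∑' n : ℕ, (if w n then (1:ℝ) else 0) / 2 ^ (n+1)

/-- Strict lexicographic order on binary sequences. -/
def seqLt (u v : ℕ → Bool) : Prop := ∃ n, (∀ i < n, u i = v i) ∧ u n < v n

def seqLe (u v : ℕ → Bool) : Prop := seqLt u v ∨ u = v

/-- Periodic sequence `w^∞` associated with a finite word. -/
def per (w : List Bool) : ℕ → Bool := fun n => w.getD (n % w.length) false

/-- Concatenation of a finite word and an infinite sequence. -/
def cat (w : List Bool) (x : ℕ → Bool) : ℕ → Bool :=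
  fun n => if n < w.length then w.getD n false else x (n - w.length)

/-- A finite word is balanced. -/
def BalancedWord (l : List Bool) : Prop :=
  ∀ u v : List Bool, u <:+: l → v <:+: l → u.length = v.length →
    (u.count true : ℤ) - (v.count true : ℤ) ≤ 1

/-- A finite word is cyclically balanced. -/
def CycBalanced (w : List Bool) : Prop := BalancedWord (w ++ w)

def OmegaSet (r : ℚ) (b : Bool) : Set (List Bool) :=
  {w | w.length = r.den ∧ w.count true = r.num.toNat ∧ CycBalanced w ∧ w.head? = some b}

/-- `w` is the lexicographically largest cyclically balanced word of length `q`
with `p` ones beginning with 0, where `r = p/q` in lowest terms. -/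
def IsOmegaMinus (r : ℚ) (w : List Bool) : Prop :=
  w ∈ OmegaSet r false ∧ ∀ v ∈ OmegaSet r false, v = w ∨ List.Lex (· < ·) v w

/-- `w` is the lexicographically smallest cyclically balanced word of length `q`
with `p` ones beginning with 1. -/
def IsOmegaPlus (r : ℚ) (w : List Bool) : Prop :=
  w ∈ OmegaSet r true ∧ ∀ v ∈ OmegaSet r true, v = w ∨ List.Lex (· < ·) w v

open Classical in
def omegaMinus (r : ℚ) : List Bool :=
  if h : ∃ w, IsOmegaMinus r w then h.choose else []

open Classical in
def omegaPlus (r : ℚ) : List Bool :=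
  if h : ∃ w, IsOmegaPlus r w then h.choose else []

/-- The substitution `ρ_r` applied to a word. -/
def substR (r : ℚ) (w : List Bool) : List Bool :=
  (w.map (fun b => if b then omegaPlus r else omegaMinus r)).flatten

/-- `s_n = ρ_{r_1}∘⋯∘ρ_{r_n}(0)`. -/
def sWord : List ℚ → List Bool
  | [] => [false]
  | r :: rs => substR r (sWord rs)

/-- `t_n = ρ_{r_1}∘⋯∘ρ_{r_n}(1)`. -/
def tWord : List ℚ → List Bool
  | [] => [true]
  | r :: rs => substR r (tWord rs)

/-- `Δ(r_1,…,r_n) = [π(s_n^∞), π(s_n t_n^∞)]`. -/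
def DeltaI (rs : List ℚ) : Set ℝ :=
  Set.Icc (piMap (per (sWord rs))) (piMap (cat (sWord rs) (per (tWord rs))))

/-- `Δ̃(r_1,…,r_n) = [π(s_n t_n s_n^∞), π(s_n t_n^∞)]`. -/
def DeltaTilde (rs : List ℚ) : Set ℝ :=
  Set.Icc (piMap (cat (sWord rs) (cat (tWord rs) (per (sWord rs)))))
    (piMap (cat (sWord rs) (per (tWord rs))))

/-- The exceptional set `𝒮`. -/
def Scal : Set ℝ :=
  Set.Ioo (1/4 : ℝ) (1/2) \ ⋃ r ∈ {r : ℚ | 0 < r ∧ r < 1}, DeltaI [r]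

/-- `φ(a)`. -/
def phi (a : ℝ) : ℝ := sSup {b | b ∈ Set.Ioo a 1 ∧ J a b ≠ ({0, 1} : Set ℝ)}

/-- `χ(a)`. -/
def chi (a : ℝ) : ℝ := sSup {b | b ∈ Set.Ioo a 1 ∧ ¬ (J a b).Countable}

/-- `s_n` built from the first `m` entries of an infinite sequence of rationals. -/
def sWordN (r : ℕ → ℚ) (m : ℕ) : List Bool := sWord (List.ofFn fun i : Fin m => r i)

def tWordN (r : ℕ → ℚ) (m : ℕ) : List Bool := tWord (List.ofFn fun i : Fin m => r i)

/-- `𝔰(𝐫)`, the coordinatewise limit of `ρ_{r_1}⋯ρ_{r_n}(0)`. -/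
def sLim (r : ℕ → ℚ) : ℕ → Bool := fun k => (sWordN r (k+1)).getD k false

/-- `𝔱(𝐫)`. -/
def tLim (r : ℕ → ℚ) : ℕ → Bool := fun k => (tWordN r (k+1)).getD k false

/-! ### Sequences and words -/

def homW (f : Bool → List Bool) (w : List Bool) : List Bool := w.flatMap f

def preW (x : ℕ → Bool) (n : ℕ) : List Bool := (List.range n).map x

def infS (f : Bool → List Bool) (x : ℕ → Bool) : ℕ → Bool :=
  fun k => (homW f (preW x (k+1))).getD k false

def cns (b : Bool) (x : ℕ → Bool) : ℕ → Bool := fun n => Nat.casesOn n b x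

@[simp] theorem cns_zero (b x) : cns b x 0 = b := rfl
@[simp] theorem cns_succ (b x n) : cns b x (n+1) = x n := rfl
@[simp] theorem shft_cns (b x) : shft (cns b x) = x := rfl
theorem cns_eta (x) : cns (x 0) (shft x) = x := by
  funext n; cases n <;> rfl
theorem ex_cns (x : ℕ → Bool) : ∃ b y, x = cns b y := ⟨x 0, shft x, (cns_eta x).symm⟩

theorem cns_inj {a b x y} (h : cns a x = cns b y) : a = b ∧ x = y :=
  ⟨congrFun h 0, by have := congrArg shft h; simpa using this⟩

@[simp] theorem cat_nil (x) : cat [] x = x := by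
  funext n; simp [cat]
@[simp] theorem cat_cons (b w x) : cat (b :: w) x = cns b (cat w x) := by
  funext n; cases n with
  | zero => simp [cat]
  | succ n => simp [cat]

theorem shft_iter_cat (w x) : shft^[w.length] (cat w x) = x := by
  induction w with
  | nil => simp
  | cons b w ih => simp [ih]

@[simp] theorem homW_nil (f) : homW f [] = [] := rfl
@[simp] theorem homW_cons (f b w) : homW f (b :: w) = f b ++ homW f w := by simp [homW]
@[simp] theorem homW_append (f v w) : homW f (v ++ w) = homW f v ++ homW f w := by simp [homW]

theorem homW_homW (g f w) : homW g (homW f w) = homW (fun b => homW g (f b)) w := by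
  induction w with
  | nil => rfl
  | cons b w ih => simp [ih]

@[simp] theorem preW_length (x n) : (preW x n).length = n := by simp [preW]

theorem preW_succ (x n) : preW x (n+1) = x 0 :: preW (shft x) n := by
  simp only [preW, List.range_succ_eq_map, List.map_cons, List.map_map]
  rfl

theorem preW_isPre (x) {n m : ℕ} (h : n ≤ m) : preW x n <+: preW x m := by
  induction n generalizing x m with
  | zero => simp [preW]
  | succ n ih =>
    obtain ⟨m, rfl⟩ : ∃ m', m = m' + 1 := ⟨m - 1, by omega⟩
    rw [preW_succ, preW_succ]
    exact (List.prefix_cons_inj _).2 (ih (shft x) (by omega))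

theorem homW_isPre (f) {v w : List Bool} (h : v <+: w) : homW f v <+: homW f w := by
  obtain ⟨t, rfl⟩ := h
  exact ⟨homW f t, by simp⟩

theorem getD_isPre {v w : List Bool} (h : v <+: w) {k : ℕ} (hk : k < v.length) :
    w.getD k false = v.getD k false := by
  obtain ⟨t, rfl⟩ := h
  exact List.getD_append _ _ _ _ hk

theorem homW_length {f : Bool → List Bool} {c : ℕ} (hf : ∀ b, c ≤ (f b).length) (w : List Bool) :
    c * w.length ≤ (homW f w).length := by
  induction w with
  | nil => simp
  | cons b w ih => have := hf b; simp; linarith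

theorem infS_eq {f : Bool → List Bool} (hf : ∀ b, 1 ≤ (f b).length) (x : ℕ → Bool) {k n : ℕ}
    (hk : k < (homW f (preW x n)).length) :
    infS f x k = (homW f (preW x n)).getD k false := by
  have h1 := homW_length hf (preW x (k+1))
  simp only [preW_length, one_mul] at h1
  rcases le_total n (k+1) with h | h
  · exact getD_isPre (homW_isPre f (preW_isPre x h)) hk
  · exact (getD_isPre (homW_isPre f (preW_isPre x h)) (by omega)).symm

theorem infS_rec {f : Bool → List Bool} (hf : ∀ b, 1 ≤ (f b).length) (x : ℕ → Bool) :
    infS f x = cat (f (x 0)) (infS f (shft x)) := by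
  funext k
  have h1 := homW_length hf (preW (shft x) k)
  simp only [preW_length, one_mul] at h1
  have h2 := hf (x 0)
  simp only [cat]
  split_ifs with h
  · simp only [infS, preW_succ, homW_cons]
    exact List.getD_append _ _ _ _ h
  · rw [infS_eq hf (shft x) (n := k) (by omega)]
    simp only [infS, preW_succ, homW_cons]
    exact List.getD_append_right _ _ _ _ (by omega)

theorem preW_infS {f : Bool → List Bool} (hf : ∀ b, 1 ≤ (f b).length) (x : ℕ → Bool) (m : ℕ) :
    preW (infS f x) (homW f (preW x m)).length = homW f (preW x m) := by
  apply List.ext_getElem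
  · simp
  · intro i h1 h2
    simp only [preW, List.getElem_map, List.getElem_range]
    rw [infS_eq hf x (n := m) h2, List.getD_eq_getElem _ _ h2]
    rfl

theorem infS_comp {f g : Bool → List Bool} (hf : ∀ b, 1 ≤ (f b).length)
    (hg : ∀ b, 1 ≤ (g b).length) (x : ℕ → Bool) :
    infS (fun b => homW g (f b)) x = infS g (infS f x) := by
  funext k
  have h1 := homW_length hf (preW x (k+1))
  have h2 := homW_length hg (homW f (preW x (k+1)))
  simp only [preW_length, one_mul] at h1 h2
  rw [infS_eq hg (infS f x) (n := (homW f (preW x (k+1))).length) (by rw [preW_infS hf]; omega),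
    preW_infS hf, homW_homW]
  rfl

/-! ### Lexicographic order -/

def LL (x y : ℕ → Bool) : Prop := toLex x < toLex y
def LQ (x y : ℕ → Bool) : Prop := toLex x ≤ toLex y

theorem LL_iff (x y) : LL x y ↔ ∃ n, (∀ i < n, x i = y i) ∧ x n < y n := Iff.rfl

theorem not_LL {x y} : ¬ LL x y ↔ LQ y x := not_lt (α := Lex (ℕ → Bool))
theorem not_LQ {x y} : ¬ LQ x y ↔ LL y x := not_le (α := Lex (ℕ → Bool))
theorem LQ_refl (x) : LQ x x := le_refl (toLex x)
theorem LL.le {x y} (h : LL x y) : LQ x y := le_of_lt (α := Lex (ℕ → Bool)) h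
theorem LQ.trans {x y z} (h : LQ x y) (h' : LQ y z) : LQ x z := le_trans (α := Lex (ℕ → Bool)) h h'
theorem LL.trans_le {x y z} (h : LL x y) (h' : LQ y z) : LL x z :=
  lt_of_lt_of_le (α := Lex (ℕ → Bool)) h h'
theorem LQ.trans_lt {x y z} (h : LQ x y) (h' : LL y z) : LL x z :=
  lt_of_le_of_lt (α := Lex (ℕ → Bool)) h h'
theorem LL_irrefl (x) : ¬ LL x x := lt_irrefl (toLex x)
theorem LL_or_of_ne {x y : ℕ → Bool} (h : x ≠ y) : LL x y ∨ LL y x :=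
  lt_or_gt_of_ne (α := Lex (ℕ → Bool)) h
theorem LQ_iff {x y} : LQ x y ↔ LL x y ∨ x = y := le_iff_lt_or_eq (α := Lex (ℕ → Bool))

@[simp] theorem LL_cns (a b x y) : LL (cns a x) (cns b y) ↔ a < b ∨ (a = b ∧ LL x y) := by
  simp only [LL_iff]
  constructor
  · rintro ⟨n, h1, h2⟩
    cases n with
    | zero => exact Or.inl h2
    | succ n =>
      exact Or.inr ⟨h1 0 (by omega), n, fun i hi => h1 (i+1) (by omega), h2⟩
  · rintro (h | ⟨rfl, n, h1, h2⟩)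
    · exact ⟨0, by simp, h⟩
    · refine ⟨n+1, ?_, h2⟩
      intro i hi
      cases i with
      | zero => rfl
      | succ i => exact h1 i (by omega)

@[simp] theorem LQ_cns (a b x y) : LQ (cns a x) (cns b y) ↔ a < b ∨ (a = b ∧ LQ x y) := by
  rw [← not_LL, LL_cns, ← not_LL]
  cases a <;> cases b <;> simp

theorem LL_cat (w x y) : LL (cat w x) (cat w y) ↔ LL x y := by
  induction w with
  | nil => simp
  | cons b w ih => simp [ih]

def c0 : ℕ → Bool := fun _ => false
def c1 : ℕ → Bool := fun _ => true
theorem c0_eq : c0 = cns false c0 := by funext n; cases n <;> rfl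
theorem c1_eq : c1 = cns true c1 := by funext n; cases n <;> rfl

theorem c0_le (x) : LQ c0 x := by
  rw [← not_LL]; rintro ⟨n, -, h⟩; exact absurd h (not_lt.2 (Bool.false_le _))
theorem le_c1 (x) : LQ x c1 := by
  rw [← not_LL]; rintro ⟨n, -, h⟩; exact absurd h (not_lt.2 (Bool.le_true _))

/-- letterwise images are head preserving -/
def HP (f : Bool → List Bool) : Prop := ∀ b, ∃ w, f b = b :: w

theorem HP.len {f} (h : HP f) (b) : 1 ≤ (f b).length := by
  obtain ⟨w, hw⟩ := h b; simp [hw]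

theorem infS_head {f} (h : HP f) (x) : infS f x 0 = x 0 := by
  obtain ⟨w, hw⟩ := h (x 0)
  rw [infS_rec h.len, hw]; simp

theorem infS_mono {f} (h : HP f) {x y} (hxy : LL x y) : LL (infS f x) (infS f y) := by
  obtain ⟨n, h1, h2⟩ := hxy
  induction n generalizing x y with
  | zero =>
    refine ⟨0, by simp, ?_⟩
    show infS f x 0 < infS f y 0
    rw [infS_head h, infS_head h]; exact h2
  | succ n ih =>
    have h0 : x 0 = y 0 := h1 0 (by omega)
    rw [infS_rec h.len x, infS_rec h.len y, h0, LL_cat]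
    exact ih (x := shft x) (y := shft y) (fun i hi => h1 (i+1) (by omega)) h2

theorem infS_monoQ {f} (h : HP f) {x y} (hxy : LQ x y) : LQ (infS f x) (infS f y) := by
  rcases LQ_iff.1 hxy with h1 | rfl
  · exact (infS_mono h h1).le
  · exact LQ_refl _

theorem infS_inj {f} (h : HP f) : Function.Injective (infS f) := by
  intro x y hxy
  by_contra hne
  rcases LL_or_of_ne hne with h1 | h1
  · have := infS_mono h h1; rw [hxy] at this; exact LL_irrefl _ this
  · have := infS_mono h h1; rw [hxy] at this; exact LL_irrefl _ this

theorem infS_tail {f} (h : HP f) (y : ℕ → Bool) (j : ℕ) :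
    ∃ k, shft^[k] (infS f y) = infS f (shft^[j] y) := by
  induction j generalizing y with
  | zero => exact ⟨0, rfl⟩
  | succ j ih =>
    obtain ⟨k, hk⟩ := ih (shft y)
    refine ⟨k + (f (y 0)).length, ?_⟩
    rw [infS_rec h.len, Function.iterate_add_apply, shft_iter_cat, hk]
    rfl

/-- parsing lemma -/
theorem parse {f} (h : HP f) (P : (ℕ → Bool) → Prop)
    (hP : ∀ y, P y → ∃ b y', P y' ∧ y = cat (f b) y') {y} (hy : P y) : ∃ x, y = infS f x := by
  choose! β Y h1 h2 using hP
  have hit : ∀ n, P (Y^[n] y) := by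
    intro n
    induction n with
    | zero => exact hy
    | succ n ih => rw [Function.iterate_succ_apply']; exact h1 _ ih
  refine ⟨fun n => β (Y^[n] y), ?_⟩
  have key : ∀ n y, P y → ∀ k < n, y k = infS f (fun n => β (Y^[n] y)) k := by
    intro n
    induction n with
    | zero => intro y _ k hk; omega
    | succ n ih =>
      intro y hy k hk
      rw [infS_rec h.len]
      conv_lhs => rw [h2 y hy]
      change cat (f (β y)) (Y y) k = cat (f (β y)) (infS f (fun n => β (Y^[n] (Y y)))) k
      simp only [cat]
      split_ifs with hlt
      · rfl
      · have := h.len (β y)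
        exact ih (Y y) (h1 y hy) (k - (f (β y)).length) (by omega)
  funext k
  exact key (k+1) y hy k (by omega)

/-! ### The three elementary substitutions -/

def fA (b : Bool) : List Bool := if b then [true, false] else [false]
def fB (b : Bool) : List Bool := if b then [true] else [false, true]
def fM (b : Bool) : List Bool := if b then [true, false] else [false, true]

theorem hpA : HP fA := by intro b; cases b <;> simp [fA]
theorem hpB : HP fB := by intro b; cases b <;> simp [fB]
theorem hpM : HP fM := by intro b; cases b <;> simp [fM]

@[simp] theorem iA0 (x) : infS fA (cns false x) = cns false (infS fA x) := by
  rw [infS_rec hpA.len]; simp [fA]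
@[simp] theorem iA1 (x) : infS fA (cns true x) = cns true (cns false (infS fA x)) := by
  rw [infS_rec hpA.len]; simp [fA]
@[simp] theorem iB0 (x) : infS fB (cns false x) = cns false (cns true (infS fB x)) := by
  rw [infS_rec hpB.len]; simp [fB]
@[simp] theorem iB1 (x) : infS fB (cns true x) = cns true (infS fB x) := by
  rw [infS_rec hpB.len]; simp [fB]
@[simp] theorem iM0 (x) : infS fM (cns false x) = cns false (cns true (infS fM x)) := by
  rw [infS_rec hpM.len]; simp [fM]
@[simp] theorem iM1 (x) : infS fM (cns true x) = cns true (cns false (infS fM x)) := by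
  rw [infS_rec hpM.len]; simp [fM]

/-- survivors of the symbolic hole `(s,u]` -/
def Sv (s u : ℕ → Bool) : Set (ℕ → Bool) :=
  {x | ∀ k, ¬ (LL s (shft^[k] x) ∧ LQ (shft^[k] x) u)}

theorem Sv.tail {s u b x} (h : cns b x ∈ Sv s u) : x ∈ Sv s u := fun k => by
  simpa using h (k+1)
theorem Sv.iter {s u x} (h : x ∈ Sv s u) (j) : shft^[j] x ∈ Sv s u := fun k => by
  have := h (k+j); rwa [Function.iterate_add_apply] at this
theorem Sv.now {s u x} (h : x ∈ Sv s u) (h1 : LL s x) (h2 : LQ x u) : False := h 0 ⟨h1, h2⟩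

/-- eventually in `C` -/
def Ev (C : Set (ℕ → Bool)) : Set (ℕ → Bool) := {x | ∃ k, shft^[k] x ∈ C}

theorem Ev_countable {C : Set (ℕ → Bool)} (hC : C.Countable) : (Ev C).Countable := by
  have h1 : ∀ k, {x | shft^[k] x ∈ C}.Countable := by
    intro k
    induction k with
    | zero => exact hC
    | succ k ih =>
      refine ((ih.image (cns false)).union (ih.image (cns true))).mono ?_
      intro x hx
      obtain ⟨b, y, rfl⟩ := ex_cns x
      have : shft^[k] y ∈ C := by simpa using hx
      cases b
      · exact Or.inl ⟨y, this, rfl⟩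
      · exact Or.inr ⟨y, this, rfl⟩
  refine (Set.countable_iUnion h1).mono ?_
  rintro x ⟨k, hk⟩
  exact Set.mem_iUnion.2 ⟨k, hk⟩

def EvC : Set (ℕ → Bool) := Ev {c0, c1}
theorem EvC_countable : EvC.Countable := Ev_countable (by simp)

/-- survivors are eventually images -/
def Up (f : Bool → List Bool) : Prop := ∀ s u, s 0 = false → u 0 = true →
  ∀ x ∈ Sv (infS f s) (infS f u), x ∈ EvC ∨ ∃ k y, shft^[k] x = infS f y

theorem up_step {f} (hf : HP f) (hu : Up f) {s u} (hs : s 0 = false) (hu0 : u 0 = true)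
    (hc : (Sv s u).Countable) : (Sv (infS f s) (infS f u)).Countable := by
  refine (EvC_countable.union (Ev_countable (hc.image (infS f)))).mono ?_
  intro x hx
  rcases hu s u hs hu0 x hx with h | ⟨k, y, h⟩
  · exact Or.inl h
  · refine Or.inr ⟨k, y, ?_, h.symm⟩
    have hy := Sv.iter hx k
    rw [h] at hy
    rintro j ⟨h1, h2⟩
    obtain ⟨i, hi⟩ := infS_tail hf y j
    have := Sv.iter hy i
    rw [hi] at this
    exact Sv.now this (infS_mono hf h1) (infS_monoQ hf h2)

theorem upA : Up fA := by
  intro s u hs hu x hx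
  by_cases h1 : ∃ k, x k = false
  · obtain ⟨k, hk⟩ := h1
    right
    have hz := Sv.iter hx k
    have hz0 : (shft^[k] x) 0 = false := by
      have : ∀ k (x : ℕ → Bool), (shft^[k] x) 0 = x k := by
        intro k
        induction k with
        | zero => intro x; rfl
        | succ k ih => intro x; exact ih (shft x)
      rw [this, hk]
    generalize hz' : shft^[k] x = z at *
    rw [← cns_eta z, hz0] at hz
    have := parse hpA (fun y => cns false y ∈ Sv (infS fA s) (infS fA u)) ?_ hz
    · obtain ⟨y, hy⟩ := this
      refine ⟨k, cns false y, ?_⟩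
      rw [iA0, ← hy, hz', ← hz0, cns_eta]
    · intro y hy
      obtain ⟨b, y, rfl⟩ := ex_cns y
      cases b
      · exact ⟨false, y, Sv.tail hy, by simp [fA]⟩
      · obtain ⟨b, y, rfl⟩ := ex_cns y
        cases b
        · exact ⟨true, y, Sv.tail (Sv.tail hy), by simp [fA]⟩
        · exfalso
          rw [← cns_eta s, ← cns_eta u, hs, hu] at hy
          refine Sv.now hy ?_ ?_
          · obtain ⟨b, w, hw⟩ := ex_cns (shft s)
            rw [hw]; cases b <;> simp
          · simp
  · left
    refine ⟨0, Or.inr ?_⟩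
    funext k
    simp at h1
    simpa [c1] using h1 k

theorem shft_iter_apply (k j) (x : ℕ → Bool) : (shft^[k] x) j = x (k + j) := by
  induction k generalizing x with
  | zero => simp
  | succ k ih => 
    rw [Function.iterate_succ_apply, ih]
    show x (k + j + 1) = _
    congr 1; omega

theorem upB : Up fB := by
  intro s u hs hu x hx
  by_cases h1 : ∃ k, x k = true
  · obtain ⟨k, hk⟩ := h1
    right
    have hz := Sv.iter hx k
    have hz0 : (shft^[k] x) 0 = true := by rw [shft_iter_apply]; exact hk
    generalize hz' : shft^[k] x = z at *
    rw [← cns_eta z, hz0] at hz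
    have := parse hpB (fun y => cns true y ∈ Sv (infS fB s) (infS fB u)) ?_ hz
    · obtain ⟨y, hy⟩ := this
      refine ⟨k, cns true y, ?_⟩
      rw [iB1, ← hy, hz', ← hz0, cns_eta]
    · intro y hy
      obtain ⟨b, y, rfl⟩ := ex_cns y
      cases b
      · obtain ⟨b, y, rfl⟩ := ex_cns y
        cases b
        · exfalso
          rw [← cns_eta s, ← cns_eta u, hs, hu] at hy
          refine Sv.now hy ?_ ?_
          · simp
          · obtain ⟨b, w, hw⟩ := ex_cns (shft u)
            rw [hw]; cases b <;> simp
        · exact ⟨false, y, Sv.tail (Sv.tail hy), by simp [fB]⟩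
      · exact ⟨true, y, Sv.tail hy, by simp [fB]⟩
  · left
    refine ⟨0, Or.inl ?_⟩
    funext k
    simp at h1
    simpa [c0] using h1 k

/-- prepend `b` `k` times -/
def rep (b : Bool) (k : ℕ) (x : ℕ → Bool) : ℕ → Bool := (cns b)^[k] x
/-- prepend the word `b, !b` `k` times -/
def rep2 (b : Bool) (k : ℕ) (x : ℕ → Bool) : ℕ → Bool := (fun z => cns b (cns (!b) z))^[k] x

theorem rep2_succ (b k x) : rep2 b (k+1) x = cns b (cns (!b) (rep2 b k x)) :=
  Function.iterate_succ_apply' _ _ _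
theorem rep2_succ' (b k x) : rep2 b (k+1) x = rep2 b k (cns b (cns (!b) x)) :=
  Function.iterate_succ_apply _ _ _

theorem rep2_big (k x) : LL (infS fM c1) (rep2 true k (cns true (cns true x))) := by
  induction k with
  | zero => rw [c1_eq]; simp [rep2]
  | succ k ih => rw [c1_eq, rep2_succ]; simpa using ih
theorem rep2_small (k x) : LL (rep2 false k (cns false (cns false x))) (infS fM c0) := by
  induction k with
  | zero => rw [c0_eq]; simp [rep2]
  | succ k ih => rw [c0_eq, rep2_succ]; simpa using ih

theorem parseM {s u} {y}
    (h1 : ∃ k, cns false (cns true (rep2 true k y)) ∈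
      Sv (infS fM (cns false s)) (infS fM (cns true u)))
    (h2 : ∃ k, cns true (cns false (rep2 false k y)) ∈
      Sv (infS fM (cns false s)) (infS fM (cns true u))) :
    ∃ x, y = infS fM x := by
  set S := Sv (infS fM (cns false s)) (infS fM (cns true u)) with hS
  refine parse hpM (fun y =>
    (∃ k, cns false (cns true (rep2 true k y)) ∈ S) ∧
    (∃ k, cns true (cns false (rep2 false k y)) ∈ S)) ?_ ⟨h1, h2⟩
  clear h1 h2 y
  rintro y ⟨⟨k, h1⟩, ⟨l, h2⟩⟩
  have hrep : ∀ b k y, rep2 b k y ∈ S → y ∈ S := by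
    intro b k
    induction k with
    | zero => intro y h; exact h
    | succ k ih => intro y h; rw [rep2_succ] at h; exact ih y (Sv.tail (Sv.tail h))
  obtain ⟨b, y, rfl⟩ := ex_cns y
  obtain ⟨c, y, rfl⟩ := ex_cns y
  cases b <;> cases c
  · exfalso
    refine Sv.now h2 (by simp) ?_
    have : LQ (cns true (cns false (infS fM c0))) (infS fM (cns true u)) := by
      rw [← iM1]
      exact infS_monoQ hpM (by simpa using c0_le _)
    exact LL.le (LL.trans_le (by simpa using rep2_small l y) this)
  · refine ⟨false, y, ⟨⟨0, ?_⟩, ⟨l+1, ?_⟩⟩, by simp [fM]⟩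
    · exact hrep _ _ _ (Sv.tail (Sv.tail h1))
    · rw [rep2_succ']
      exact h2
  · refine ⟨true, y, ⟨⟨k+1, ?_⟩, ⟨0, ?_⟩⟩, by simp [fM]⟩
    · rw [rep2_succ']
      exact h1
    · exact hrep _ _ _ (Sv.tail (Sv.tail h2))
  · exfalso
    refine Sv.now h1 ?_ (by simp)
    have : LQ (infS fM (cns false s)) (cns false (cns true (infS fM c1))) := by
      rw [← iM0]
      exact infS_monoQ hpM (by simpa using le_c1 _)
    exact LQ.trans_lt this (by simpa using rep2_big k y)

theorem upM : Up fM := by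
  intro s u hs hu x hx
  obtain ⟨b, s, rfl⟩ := ex_cns s
  obtain ⟨c, u, rfl⟩ := ex_cns u
  obtain rfl : b = false := hs
  obtain rfl : c = true := hu
  by_cases h : ∃ k, x k = false ∧ x (k+1) = true
  · right
    by_cases h011 : ∃ k y, shft^[k] x = cns false (cns true (cns true y))
    · obtain ⟨k, y, hk⟩ := h011
      have hz := Sv.iter hx k
      rw [hk] at hz
      obtain ⟨b, y, rfl⟩ := ex_cns y
      cases b
      · obtain ⟨w, hw⟩ := parseM (s := s) (u := u) (y := y) ⟨1, hz⟩ ⟨0, Sv.tail (Sv.tail hz)⟩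
        exact ⟨k, cns false (cns true w), by rw [hk, hw]; simp⟩
      · exfalso
        refine Sv.now hz ?_ (by simp)
        have : LQ (infS fM (cns false s)) (cns false (cns true (infS fM c1))) := by
          rw [← iM0]
          exact infS_monoQ hpM (by simpa using le_c1 _)
        exact LQ.trans_lt this (by rw [c1_eq]; simp)
    by_cases h100 : ∃ k y, shft^[k] x = cns true (cns false (cns false y))
    · obtain ⟨k, y, hk⟩ := h100
      have hz := Sv.iter hx k
      rw [hk] at hz
      obtain ⟨b, y, rfl⟩ := ex_cns y
      cases b
      · exfalso
        refine Sv.now hz (by simp) ?_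
        have : LQ (cns true (cns false (infS fM c0))) (infS fM (cns true u)) := by
          rw [← iM1]
          exact infS_monoQ hpM (by simpa using c0_le _)
        exact LL.le (LL.trans_le (by rw [c0_eq]; simp) this)
      · obtain ⟨w, hw⟩ := parseM (s := s) (u := u) (y := y) ⟨0, Sv.tail (Sv.tail hz)⟩ ⟨1, hz⟩
        exact ⟨k, cns true (cns false w), by rw [hk, hw]; simp⟩
    obtain ⟨k, hk1, hk2⟩ := h
    have hz : ∃ y, shft^[k] x = cns false (cns true y) := by
      refine ⟨shft^[k+2] x, ?_⟩
      funext j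
      rw [shft_iter_apply]
      rcases j with _ | _ | j
      · exact hk1
      · exact hk2
      · simp only [cns_succ, shft_iter_apply]; congr 1; omega
    refine ⟨k, parse hpM (fun y => (∃ j, y = shft^[j] x) ∧ ∃ z, y = cns false (cns true z)) ?_
      ⟨⟨k, rfl⟩, hz⟩⟩
    rintro y ⟨⟨j, hj⟩, z, rfl⟩
    have hj2 : shft^[j+1] x = cns true z := by
      rw [Function.iterate_succ_apply', ← hj]; rfl
    have hj3 : shft^[j+2] x = z := by
      rw [Function.iterate_succ_apply', hj2]; rfl
    refine ⟨false, z, ⟨⟨j+2, hj3.symm⟩, ?_⟩, by simp [fM]⟩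
    obtain ⟨b, z, rfl⟩ := ex_cns z
    cases b
    · obtain ⟨b, z, rfl⟩ := ex_cns z
      cases b
      · exact absurd ⟨_, _, hj2⟩ h100
      · exact ⟨z, rfl⟩
    · exact absurd ⟨_, _, hj.symm⟩ h011
  · left
    push Not at h
    by_cases h0 : ∃ k, x k = false
    · obtain ⟨k, hk⟩ := h0
      refine ⟨k, Or.inl ?_⟩
      funext j
      rw [shft_iter_apply]
      induction j with
      | zero => exact hk
      | succ j ih => simpa [c0, add_assoc] using h (k+j) ih
    · refine ⟨0, Or.inr ?_⟩
      funext k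
      simp at h0
      simpa [c1] using h0 k

/-! ### Lower bound: transport of survivors -/

def KK (s u x : ℕ → Bool) : Prop :=
  ∀ k, LQ (cns false (shft^[k] x)) s ∧ LQ u (cns true (shft^[k] x))

theorem KK_of {s u x} (P : (ℕ → Bool) → Prop) (hx : P x) (hP : ∀ y, P y → P (shft y))
    (hb : ∀ y, P y → LQ (cns false y) s ∧ LQ u (cns true y)) : KK s u x := by
  intro k
  apply hb
  induction k with
  | zero => exact hx
  | succ k ih => rw [Function.iterate_succ_apply']; exact hP _ ih

theorem le_cns_true (x) : LQ x (cns true x) := by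
  rw [← not_LL]
  rintro ⟨n, h1, h2⟩
  have : ∀ i ≤ n, x i = true := by
    intro i
    induction i with
    | zero =>
      intro _
      rcases Nat.eq_zero_or_pos n with h | h
      · subst h
        exact absurd h2 (not_lt.2 (Bool.le_true _))
      · exact (h1 0 h).symm
    | succ i ih =>
      intro hi
      rcases Nat.lt_or_ge (i+1) n with h | h
      · exact (h1 (i+1) h).symm.trans (ih (by omega))
      · obtain rfl : i + 1 = n := by omega
        have h3 : x i < x (i+1) := h2
        rw [ih (by omega)] at h3
        exact absurd h3 (not_lt.2 (Bool.le_true _))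
  have h3 := this n le_rfl
  cases n with
  | zero =>
    have h4 : true < x 0 := h2
    exact absurd h4 (not_lt.2 (Bool.le_true _))
  | succ n =>
    have h4 : x n < x (n+1) := h2
    rw [this n (by omega)] at h4
    exact absurd h4 (not_lt.2 (Bool.le_true _))

theorem cns_false_le (x) : LQ (cns false x) x := by
  rw [← not_LL]
  rintro ⟨n, h1, h2⟩
  have : ∀ i < n, x i = false := by
    intro i
    induction i with
    | zero => intro h; exact h1 0 h
    | succ i ih => intro h; exact (h1 (i+1) h).trans (ih (by omega))
  cases n with
  | zero =>
    have h4 : x 0 < false := h2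
    exact absurd h4 (not_lt.2 (Bool.false_le _))
  | succ n =>
    have h4 : x (n+1) < x n := h2
    rw [this n (by omega)] at h4
    exact absurd h4 (not_lt.2 (Bool.false_le _))

/-- `x` is a tail of `y` -/
def Tl (x z : ℕ → Bool) : Prop := ∃ j, z = shft^[j] x

theorem Tl.tail {x b z} (h : Tl x (cns b z)) : Tl x z := by
  obtain ⟨j, hj⟩ := h
  exact ⟨j+1, by rw [Function.iterate_succ_apply', ← hj]; rfl⟩

def Lo (f : Bool → List Bool) : Prop :=
  ∀ s u x, KK (cns false (cns true s)) (cns true (cns false u)) x →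
    KK (infS f (cns false (cns true s))) (infS f (cns true (cns false u))) (infS f x)

theorem loA : Lo fA := by
  intro s u x h
  refine KK_of (fun y => ∃ z, Tl x z ∧ (y = infS fA z ∨ y = cns false (infS fA z)))
    ⟨x, ⟨0, rfl⟩, Or.inl rfl⟩ ?_ ?_
  · rintro y ⟨z, hz, (rfl | rfl)⟩
    · obtain ⟨b, z, rfl⟩ := ex_cns z
      refine ⟨z, Tl.tail hz, ?_⟩
      cases b <;> simp
    · exact ⟨z, hz, Or.inl rfl⟩
  · rintro y ⟨z, ⟨j, hz⟩, hy⟩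
    have h1 := infS_monoQ hpA (h j).1
    have h2 := infS_monoQ hpA (h j).2
    rw [← hz, iA0] at h1
    rw [← hz, iA1 (x := z)] at h2
    rcases hy with (rfl | rfl)
    · exact ⟨h1, h2.trans (by simpa using cns_false_le _)⟩
    · exact ⟨LQ.trans (by simpa using cns_false_le _) h1, h2⟩

theorem loB : Lo fB := by
  intro s u x h
  refine KK_of (fun y => ∃ z, Tl x z ∧ (y = infS fB z ∨ y = cns true (infS fB z)))
    ⟨x, ⟨0, rfl⟩, Or.inl rfl⟩ ?_ ?_
  · rintro y ⟨z, hz, (rfl | rfl)⟩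
    · obtain ⟨b, z, rfl⟩ := ex_cns z
      refine ⟨z, Tl.tail hz, ?_⟩
      cases b <;> simp
    · exact ⟨z, hz, Or.inl rfl⟩
  · rintro y ⟨z, ⟨j, hz⟩, hy⟩
    have h1 := infS_monoQ hpB (h j).1
    have h2 := infS_monoQ hpB (h j).2
    rw [← hz, iB0 (x := z)] at h1
    rw [← hz, iB1 (x := z)] at h2
    rcases hy with (rfl | rfl)
    · exact ⟨LQ.trans (by simpa using le_cns_true _) h1, h2⟩
    · exact ⟨h1, h2.trans (by simpa using le_cns_true _)⟩

theorem loM : Lo fM := by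
  intro s u x h
  refine KK_of (fun y => ∃ z, Tl x z ∧ (y = infS fM z ∨ y = cns true (infS fM z) ∨
    y = cns false (infS fM z)))
    ⟨x, ⟨0, rfl⟩, Or.inl rfl⟩ ?_ ?_
  · rintro y ⟨z, hz, (rfl | rfl | rfl)⟩
    · obtain ⟨b, z, rfl⟩ := ex_cns z
      refine ⟨z, Tl.tail hz, ?_⟩
      cases b <;> simp
    · exact ⟨z, hz, Or.inl rfl⟩
    · exact ⟨z, hz, Or.inl rfl⟩
  · rintro y ⟨z, ⟨j, hz⟩, hy⟩
    have h1 := infS_monoQ hpM (h j).1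
    have h2 := infS_monoQ hpM (h j).2
    rw [← hz, iM0 (x := z)] at h1
    rw [← hz, iM1 (x := z)] at h2
    rcases hy with (rfl | rfl | rfl)
    · obtain ⟨b, w, rfl⟩ := ex_cns z
      cases b <;> simp
    · exact ⟨h1, by simp⟩
    · exact ⟨by simp, h2⟩

/-- uncountability at the base level -/
theorem KK_base (s : ℕ → Bool) (j : ℕ) (hj : s j = true) :
    ¬ {x | KK (cns false (cns true s)) (cns true (cns false c0)) x}.Countable := by
  intro hc
  let e : (ℕ → Bool) → (ℕ → Bool) := fun y k => decide (j + 2 ∣ k) && y (k / (j+2))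
  have he : Function.Injective e := by
    intro y y' h
    funext k
    have := congrFun h ((j+2) * k)
    simpa [e] using this
  have hsub : Set.range e ⊆ {x | KK (cns false (cns true s)) (cns true (cns false c0)) x} := by
    rintro _ ⟨y, rfl⟩ k
    refine ⟨?_, by rw [← c0_eq]; simpa using c0_le _⟩
    have h1 : ∀ i, (shft^[k] (e y)) i = e y (k + i) := fun i => shft_iter_apply _ _ _
    generalize shft^[k] (e y) = z at h1
    obtain ⟨b, z, rfl⟩ := ex_cns z
    cases b
    · simp
    · simp only [LQ_cns, lt_self_iff_false, true_and, false_or]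
      rw [← not_LL]
      have h0 : j + 2 ∣ k := by
        have := h1 0
        simp [e] at this
        exact this.1
      have hz : ∀ i ≤ j, z i = false := by
        intro i hi
        have := h1 (i+1)
        rw [cns_succ] at this
        rw [this]
        have : ¬ (j + 2 ∣ k + (i+1)) := by
          intro hd
          have := (Nat.dvd_add_right h0).1 hd
          have := Nat.le_of_dvd (by omega) this
          omega
        simp [e, this]
      rintro ⟨n, h2, h3⟩
      rcases Nat.lt_or_ge j n with h | h
      · have h4 : s j = z j := h2 j h
        rw [hj, hz j le_rfl] at h4
        exact absurd h4 (by simp)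
      · have h4 : s n < z n := h3
        rw [hz n h] at h4
        exact absurd h4 (not_lt.2 (Bool.false_le _))
  have h2 := hc.mono hsub
  have h3 : (Set.univ : Set (ℕ → Bool)).Countable :=
    Set.countable_of_injective_of_countable_image he.injOn (by rwa [Set.image_univ])
  obtain ⟨g, hg⟩ := h3.exists_eq_range ⟨c0, trivial⟩
  obtain ⟨n, hn⟩ : (fun k => !(g k k)) ∈ Set.range g := by rw [← hg]; trivial
  have := congrFun hn n
  simp at this

/-! ### Real numbers -/

theorem pi_summable (x : ℕ → Bool) : Summable fun n : ℕ => (if x n then (1:ℝ) else 0) / 2 ^ (n+1) := by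
  refine Summable.of_nonneg_of_le (fun n => by split_ifs <;> positivity) (fun n => ?_)
    (summable_geometric_two)
  rw [one_div, inv_pow, ← one_div]
  have h2 : (0:ℝ) < 2 ^ n := by positivity
  split_ifs
  · rw [pow_succ]
    apply one_div_le_one_div_of_le h2
    linarith
  · simp

theorem pi_cns (b x) : piMap (cns b x) = ((if b then 1 else 0) + piMap x) / 2 := by
  unfold piMap
  rw [(pi_summable (cns b x)).tsum_eq_zero_add]
  simp only [cns_zero, cns_succ]
  rw [add_div, ← tsum_div_const]
  congr 1
  · cases b <;> simp
  · congr 1; funext n; rw [div_div, pow_succ]; by_cases h : x n = true <;> simp [h]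

theorem pi_nonneg (x) : 0 ≤ piMap x := tsum_nonneg fun n => by split_ifs <;> positivity

theorem pi_le_one (x) : piMap x ≤ 1 := by
  have h : HasSum (fun n : ℕ => (1:ℝ) / 2 / 2 ^ n) 1 := hasSum_geometric_two' 1
  rw [← h.tsum_eq]
  refine (pi_summable x).tsum_le_tsum (fun n => ?_) h.summable
  rw [div_div, ← pow_succ']
  gcongr
  split_ifs <;> norm_num

theorem pi_close (n) : ∀ x y : ℕ → Bool, (∀ i < n, x i = y i) → |piMap x - piMap y| ≤ 1 / 2 ^ n := by
  induction n with
  | zero =>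
    intro x y _
    have := pi_nonneg x; have := pi_nonneg y; have := pi_le_one x; have := pi_le_one y
    rw [abs_le]; constructor <;> simp <;> linarith
  | succ n ih =>
    intro x y h
    have h0 := h 0 (by omega)
    have := ih (shft x) (shft y) (fun i hi => h (i+1) (by omega))
    rw [← cns_eta x, ← cns_eta y, pi_cns, pi_cns, h0]
    rw [pow_succ, ← div_div]
    rw [← sub_div, add_sub_add_left_eq_sub, abs_div, abs_two]
    gcongr

theorem pi_pos {x : ℕ → Bool} {k : ℕ} (h : x k = true) : 0 < piMap x := by
  induction k generalizing x with
  | zero =>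
    have := pi_nonneg (shft x)
    rw [← cns_eta x, pi_cns, h]; simp; linarith
  | succ k ih =>
    have := ih (x := shft x) h
    rw [← cns_eta x, pi_cns]
    split_ifs <;> linarith

theorem pi_mono {x y : ℕ → Bool} (h : LL x y) : piMap x ≤ piMap y := by
  obtain ⟨n, h1, h2⟩ := h
  induction n generalizing x y with
  | zero =>
    have h3 : x 0 < y 0 := h2
    rw [Bool.lt_iff] at h3
    have := pi_nonneg (shft y); have := pi_le_one (shft x)
    rw [← cns_eta x, ← cns_eta y, pi_cns, pi_cns, h3.1, h3.2]
    simp; linarith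
  | succ n ih =>
    have := ih (x := shft x) (y := shft y) (fun i hi => h1 (i+1) (by omega)) h2
    have h0 : x 0 = y 0 := h1 0 (by omega)
    rw [← cns_eta x, ← cns_eta y, pi_cns, pi_cns, h0]
    linarith

theorem pi_monoQ {x y : ℕ → Bool} (h : LQ x y) : piMap x ≤ piMap y := by
  rcases LQ_iff.1 h with h | rfl
  · exact pi_mono h
  · exact le_rfl

theorem EvC_shft {x} (h : x ∉ EvC) : shft x ∉ EvC := by
  rintro ⟨k, hk⟩; exact h ⟨k+1, hk⟩

theorem EvC_iter {x} (h : x ∉ EvC) (k) : shft^[k] x ∉ EvC := by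
  rintro ⟨j, hk⟩
  refine h ⟨j+k, ?_⟩
  rwa [Function.iterate_add_apply]

theorem not_EvC_true {x} (h : x ∉ EvC) : ∃ k, x k = true := by
  by_contra hc
  push Not at hc
  refine h ⟨0, Or.inl ?_⟩
  funext k
  simpa [c0] using hc k

theorem pi_strict {x y : ℕ → Bool} (hy : y ∉ EvC) (h : LL x y) : piMap x < piMap y := by
  obtain ⟨n, h1, h2⟩ := h
  induction n generalizing x y with
  | zero =>
    have h3 : x 0 < y 0 := h2
    rw [Bool.lt_iff] at h3
    obtain ⟨k, hk⟩ := not_EvC_true (EvC_shft hy)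
    have := pi_pos hk; have := pi_le_one (shft x)
    rw [← cns_eta x, ← cns_eta y, pi_cns, pi_cns, h3.1, h3.2]
    simp; linarith
  | succ n ih =>
    have := ih (x := shft x) (y := shft y) (EvC_shft hy) (fun i hi => h1 (i+1) (by omega)) h2
    have h0 : x 0 = y 0 := h1 0 (by omega)
    rw [← cns_eta x, ← cns_eta y, pi_cns, pi_cns, h0]
    linarith

theorem pi_injOn : Set.InjOn piMap EvCᶜ := by
  intro x hx y hy hxy
  by_contra hne
  rcases LL_or_of_ne hne with h | h
  · exact absurd hxy (pi_strict hy h).ne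
  · exact absurd hxy (pi_strict hx h).ne'

theorem Dbl_pi {x} (hx : x ∉ EvC) : Dbl (piMap x) = piMap (shft x) := by
  obtain ⟨b, y, rfl⟩ := ex_cns x
  rw [shft_cns, pi_cns]
  cases b
  · have := pi_le_one y
    simp only [Dbl]
    rw [if_pos (by simp; linarith)]
    simp; ring
  · obtain ⟨k, hk⟩ := not_EvC_true (EvC_shft hx)
    have := pi_pos hk
    rw [shft_cns] at this
    simp only [Dbl]
    rw [if_neg (by simp; linarith)]
    simp; ring

theorem Dbl_iter_pi {x} (hx : x ∉ EvC) (n) : Dbl^[n] (piMap x) = piMap (shft^[n] x) := by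
  induction n with
  | zero => rfl
  | succ n ih =>
    rw [Function.iterate_succ_apply', ih, Dbl_pi (EvC_iter hx n), Function.iterate_succ_apply']

/-- itinerary -/
def itin (x : ℝ) : ℕ → Bool := fun n => decide (1/2 < Dbl^[n] x)

theorem itin_shft (x) : shft (itin x) = itin (Dbl x) := rfl
theorem itin_iter (x n) : shft^[n] (itin x) = itin (Dbl^[n] x) := by
  induction n with
  | zero => rfl
  | succ n ih => rw [Function.iterate_succ_apply', ih, itin_shft, Function.iterate_succ_apply']

theorem Dbl_mem {x} (h : x ∈ Set.Icc (0:ℝ) 1) : Dbl x ∈ Set.Icc (0:ℝ) 1 := by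
  obtain ⟨h1, h2⟩ := h
  unfold Dbl
  split_ifs with h <;> constructor <;> linarith

theorem Dbl_iter_mem {x} (h : x ∈ Set.Icc (0:ℝ) 1) (n) : Dbl^[n] x ∈ Set.Icc (0:ℝ) 1 := by
  induction n with
  | zero => exact h
  | succ n ih => rw [Function.iterate_succ_apply']; exact Dbl_mem ih

theorem pi_itin {x} (h : x ∈ Set.Icc (0:ℝ) 1) : piMap (itin x) = x := by
  have key : ∀ n : ℕ, ∀ x ∈ Set.Icc (0:ℝ) 1, |piMap (itin x) - x| ≤ (1/2) ^ n := by
    intro n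
    induction n with
    | zero =>
      intro x hx
      obtain ⟨h1, h2⟩ := hx
      have := pi_nonneg (itin x); have := pi_le_one (itin x)
      rw [abs_le]; constructor <;> simp <;> linarith
    | succ n ih =>
      intro x hx
      have h1 := ih (Dbl x) (Dbl_mem hx)
      have h2 : piMap (itin x) - x = (piMap (itin (Dbl x)) - Dbl x) / 2 := by
        rw [← cns_eta (itin x), pi_cns, itin_shft]
        by_cases hx2 : x ≤ 1/2
        · have : itin x 0 = false := by simp [itin] at hx2 ⊢; exact hx2
          rw [this]; simp [Dbl] at hx2 ⊢; rw [if_pos hx2]; ring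
        · have : itin x 0 = true := by simp [itin] at hx2 ⊢; exact hx2
          rw [this]; simp [Dbl] at hx2 ⊢; rw [if_neg (not_le.2 hx2)]; ring
      rw [h2, abs_div, abs_two, pow_succ]
      linarith
  have hl : Filter.Tendsto (fun n : ℕ => ((1:ℝ)/2) ^ n) Filter.atTop (nhds 0) :=
    tendsto_pow_atTop_nhds_zero_of_lt_one (by norm_num) (by norm_num)
  have := ge_of_tendsto' hl (fun n => key n x h)
  have := abs_nonpos_iff.1 this
  linarith

theorem J_countable {s u : ℕ → Bool} {b : ℝ} (hb : piMap u < b) (hc : (Sv s u).Countable) :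
    (J (piMap s) b).Countable := by
  refine ((hc.union EvC_countable).image piMap).mono ?_
  rintro x ⟨hx, hJ⟩
  refine ⟨itin x, ?_, pi_itin hx⟩
  by_cases hE : itin x ∈ EvC
  · exact Or.inr hE
  · left
    rintro k ⟨h1, h2⟩
    have h3 := pi_strict (EvC_iter hE k) h1
    have h4 := pi_monoQ h2
    rw [itin_iter, pi_itin (Dbl_iter_mem hx k)] at h3 h4
    exact hJ k ⟨h3, by linarith⟩

theorem J_uncountable {s u : ℕ → Bool} (hc : ¬ {x | KK s u x}.Countable) :
    ¬ (J (piMap s) (piMap u)).Countable := by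
  intro hJ
  apply hc
  have h1 : ({x | KK s u x} \ EvC).Countable := by
    refine Set.countable_of_injective_of_countable_image (f := piMap)
      (pi_injOn.mono fun x hx => hx.2) (hJ.mono ?_)
    rintro _ ⟨x, ⟨hx, hE⟩, rfl⟩
    refine ⟨⟨pi_nonneg x, pi_le_one x⟩, fun n => ?_⟩
    rw [Dbl_iter_pi hE]
    rintro ⟨h1, h2⟩
    obtain ⟨k1, k2⟩ := hx (n+1)
    rw [Function.iterate_succ_apply'] at k1 k2
    generalize shft^[n] x = z at *
    rw [← cns_eta z] at h1 h2
    cases hz : z 0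
    · rw [hz] at h1 
      exact absurd (pi_monoQ k1) (not_le.2 h1)
    · rw [hz] at h2
      exact absurd (pi_monoQ k2) (not_le.2 h2)
  exact (h1.union EvC_countable).mono fun x hx => by
    by_cases hE : x ∈ EvC
    · exact Or.inr hE
    · exact Or.inl ⟨hx, hE⟩

/-! ### Identification of the words `ω_r^±` -/

structure LowW (o p : ℕ) (w : List Bool) : Prop where
  cf : w.count false = o
  ct : w.count true = p
  pr : ∀ u v, u ++ v = w → ((u.count false : ℤ) - 1) * p ≤ o * u.count true ∧
    (o : ℤ) * (u.count true - 1) < u.count false * p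

structure UpW (o p : ℕ) (w : List Bool) : Prop where
  cf : w.count false = o
  ct : w.count true = p
  pr : ∀ u v, u ++ v = w → (o : ℤ) * (u.count true - 1) ≤ u.count false * p ∧
    ((u.count false : ℤ) - 1) * p < o * u.count true

theorem ctA_false (w) : (homW fA w).count false = w.count false + w.count true := by
  induction w with
  | nil => rfl
  | cons b w ih => cases b <;> simp [-List.count_false_add_count_true, -List.count_true_add_count_false, fA, ih] <;> omega
theorem ctA_true (w) : (homW fA w).count true = w.count true := by
  induction w with
  | nil => rfl
  | cons b w ih => cases b <;> simp [fA, ih]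
theorem ctB_false (w) : (homW fB w).count false = w.count false := by
  induction w with
  | nil => rfl
  | cons b w ih => cases b <;> simp [fB, ih]
theorem ctB_true (w) : (homW fB w).count true = w.count true + w.count false := by
  induction w with
  | nil => rfl
  | cons b w ih => cases b <;> simp [-List.count_false_add_count_true, -List.count_true_add_count_false, fB, ih] <;> omega

theorem prefA (w : List Bool) : ∀ u v, u ++ v = homW fA w →
    (∃ w1 w2, w1 ++ w2 = w ∧ u = homW fA w1) ∨
    (∃ w1 w2, w1 ++ true :: w2 = w ∧ u = homW fA w1 ++ [true]) := by
  induction w with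
  | nil =>
    intro u v h
    left
    simp at h
    exact ⟨[], [], rfl, by simp [h.1]⟩
  | cons b w ih =>
    intro u v h
    cases u with
    | nil => left; exact ⟨[], b :: w, rfl, rfl⟩
    | cons c u =>
      cases b
      · simp [fA] at h
        obtain ⟨rfl, h⟩ := h
        rcases ih u v h with ⟨w1, w2, rfl, rfl⟩ | ⟨w1, w2, rfl, rfl⟩
        · left; exact ⟨false :: w1, w2, rfl, by simp [fA]⟩
        · right; exact ⟨false :: w1, w2, rfl, by simp [fA]⟩
      · simp [fA] at h
        obtain ⟨rfl, h⟩ := h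
        cases u with
        | nil => right; exact ⟨[], w, rfl, rfl⟩
        | cons d u =>
          simp at h
          obtain ⟨rfl, h⟩ := h
          rcases ih u v h with ⟨w1, w2, rfl, rfl⟩ | ⟨w1, w2, rfl, rfl⟩
          · left; exact ⟨true :: w1, w2, rfl, by simp [fA]⟩
          · right; exact ⟨true :: w1, w2, rfl, by simp [fA]⟩

theorem prefB (w : List Bool) : ∀ u v, u ++ v = homW fB w →
    (∃ w1 w2, w1 ++ w2 = w ∧ u = homW fB w1) ∨
    (∃ w1 w2, w1 ++ false :: w2 = w ∧ u = homW fB w1 ++ [false]) := by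
  induction w with
  | nil =>
    intro u v h
    left
    simp at h
    exact ⟨[], [], rfl, by simp [h.1]⟩
  | cons b w ih =>
    intro u v h
    cases u with
    | nil => left; exact ⟨[], b :: w, rfl, rfl⟩
    | cons c u =>
      cases b
      · simp [fB] at h
        obtain ⟨rfl, h⟩ := h
        cases u with
        | nil => right; exact ⟨[], w, rfl, rfl⟩
        | cons d u =>
          simp at h
          obtain ⟨rfl, h⟩ := h
          rcases ih u v h with ⟨w1, w2, rfl, rfl⟩ | ⟨w1, w2, rfl, rfl⟩
          · left; exact ⟨false :: w1, w2, rfl, by simp [fB]⟩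
          · right; exact ⟨false :: w1, w2, rfl, by simp [fB]⟩
      · simp [fB] at h
        obtain ⟨rfl, h⟩ := h
        rcases ih u v h with ⟨w1, w2, rfl, rfl⟩ | ⟨w1, w2, rfl, rfl⟩
        · left; exact ⟨true :: w1, w2, rfl, by simp [fB]⟩
        · right; exact ⟨true :: w1, w2, rfl, by simp [fB]⟩

theorem LowW.A {o p w} (h : LowW o p w) : LowW (o+p) p (homW fA w) := by
  refine ⟨by rw [ctA_false, h.cf, h.ct], by rw [ctA_true, h.ct], ?_⟩
  intro u v huv
  rcases prefA w u v huv with ⟨w1, w2, hw, rfl⟩ | ⟨w1, w2, hw, rfl⟩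
  · obtain ⟨h1, h2⟩ := h.pr w1 w2 hw
    simp only [ctA_false, ctA_true]
    push_cast
    constructor <;> nlinarith
  · obtain ⟨h1, h2⟩ := h.pr w1 (true :: w2) hw
    obtain ⟨h3, h4⟩ := h.pr (w1 ++ [true]) w2 (by simp [hw])
    simp [-List.count_false_add_count_true, -List.count_true_add_count_false, ctA_false, ctA_true] at h3 h4 ⊢
    constructor <;> nlinarith

theorem LowW.B {o p w} (h : LowW o p w) : LowW o (p+o) (homW fB w) := by
  refine ⟨by rw [ctB_false, h.cf], by rw [ctB_true, h.cf, h.ct], ?_⟩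
  intro u v huv
  rcases prefB w u v huv with ⟨w1, w2, hw, rfl⟩ | ⟨w1, w2, hw, rfl⟩
  · obtain ⟨h1, h2⟩ := h.pr w1 w2 hw
    simp only [ctB_false, ctB_true]
    push_cast
    constructor <;> nlinarith
  · obtain ⟨h1, h2⟩ := h.pr w1 (false :: w2) hw
    obtain ⟨h3, h4⟩ := h.pr (w1 ++ [false]) w2 (by simp [hw])
    simp [-List.count_false_add_count_true, -List.count_true_add_count_false, ctB_false, ctB_true] at h3 h4 ⊢
    constructor <;> nlinarith

theorem UpW.A {o p w} (h : UpW o p w) : UpW (o+p) p (homW fA w) := by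
  refine ⟨by rw [ctA_false, h.cf, h.ct], by rw [ctA_true, h.ct], ?_⟩
  intro u v huv
  rcases prefA w u v huv with ⟨w1, w2, hw, rfl⟩ | ⟨w1, w2, hw, rfl⟩
  · obtain ⟨h1, h2⟩ := h.pr w1 w2 hw
    simp only [ctA_false, ctA_true]
    push_cast
    constructor <;> nlinarith
  · obtain ⟨h1, h2⟩ := h.pr w1 (true :: w2) hw
    obtain ⟨h3, h4⟩ := h.pr (w1 ++ [true]) w2 (by simp [hw])
    simp [-List.count_false_add_count_true, -List.count_true_add_count_false, ctA_false, ctA_true] at h3 h4 ⊢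
    constructor <;> nlinarith

theorem UpW.B {o p w} (h : UpW o p w) : UpW o (p+o) (homW fB w) := by
  refine ⟨by rw [ctB_false, h.cf], by rw [ctB_true, h.cf, h.ct], ?_⟩
  intro u v huv
  rcases prefB w u v huv with ⟨w1, w2, hw, rfl⟩ | ⟨w1, w2, hw, rfl⟩
  · obtain ⟨h1, h2⟩ := h.pr w1 w2 hw
    simp only [ctB_false, ctB_true]
    push_cast
    constructor <;> nlinarith
  · obtain ⟨h1, h2⟩ := h.pr w1 (false :: w2) hw
    obtain ⟨h3, h4⟩ := h.pr (w1 ++ [false]) w2 (by simp [hw])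
    simp [-List.count_false_add_count_true, -List.count_true_add_count_false, ctB_false, ctB_true] at h3 h4 ⊢
    constructor <;> nlinarith

inductive Dec : (Bool → List Bool) → Prop
  | M : Dec fM
  | A (f) : Dec f → Dec (fun b => homW fA (f b))
  | B (f) : Dec f → Dec (fun b => homW fB (f b))

theorem pref_two {a b : Bool} {u v : List Bool} (h : u ++ v = [a, b]) :
    u = [] ∨ u = [a] ∨ u = [a, b] := by
  rcases u with _ | ⟨c, _ | ⟨d, _ | ⟨e, u⟩⟩⟩
  · simp
  · simp at h; simp [h.1]
  · simp at h; simp [h.1, h.2.1]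
  · simp at h

theorem dec_exists (n : ℕ) : ∀ o p : ℕ, o + p ≤ n → 0 < o → 0 < p → Nat.Coprime o p →
    ∃ f, Dec f ∧ LowW o p (f false) ∧ UpW o p (f true) := by
  induction n with
  | zero => intro o p h ho hp; omega
  | succ n ih =>
    intro o p h ho hp hc
    rcases lt_trichotomy o p with hlt | rfl | hlt
    · obtain ⟨p, rfl⟩ : ∃ p', p = p' + o := ⟨p - o, by omega⟩
      obtain ⟨f, h1, h2, h3⟩ := ih o p (by omega) ho (by omega) (by simpa using hc)
      exact ⟨_, Dec.B f h1, h2.B, h3.B⟩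
    · obtain rfl : o = 1 := by simpa using hc
      refine ⟨fM, Dec.M, ⟨rfl, rfl, ?_⟩, ⟨rfl, rfl, ?_⟩⟩
      · intro u v h
        rcases pref_two h with rfl | rfl | rfl <;> simp
      · intro u v h
        rcases pref_two h with rfl | rfl | rfl <;> simp
    · obtain ⟨o, rfl⟩ : ∃ o', o = o' + p := ⟨o - p, by omega⟩
      obtain ⟨f, h1, h2, h3⟩ := ih o p (by omega) (by omega) hp (by simpa using hc)
      exact ⟨_, Dec.A f h1, h2.A, h3.A⟩

theorem len_counts (w : List Bool) : w.length = w.count false + w.count true :=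
  (List.count_false_add_count_true w).symm

/-- splitting of `w ++ w` -/
theorem pref_double {u v w : List Bool} (h : u ++ v = w ++ w) :
    (∃ v', u ++ v' = w) ∨ ∃ u', u = w ++ u' ∧ u' ++ v = w := by
  rcases List.append_eq_append_iff.1 h with ⟨a, ha, hb⟩ | ⟨a, ha, hb⟩
  · exact Or.inl ⟨a, ha.symm⟩
  · exact Or.inr ⟨a, ha, hb.symm⟩

theorem cyc_of {w : List Bool} (q p : ℤ) (k : ℤ)
    (h : ∀ u v, u ++ v = w ++ w → k ≤ q * u.count true - u.length * p ∧
      q * u.count true - u.length * p < k + q) : CycBalanced w := by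
  rintro u v ⟨a, b, hab⟩ ⟨a', b', hab'⟩ hl
  have h1 := h a (u ++ b) (by rw [← hab]; simp)
  have h2 := h (a ++ u) b hab
  have h3 := h a' (v ++ b') (by rw [← hab']; simp)
  have h4 := h (a' ++ v) b' hab'
  simp only [List.count_append, List.length_append, ← hl] at h1 h2 h3 h4
  push_cast at h1 h2 h3 h4
  by_contra hc
  have h5 : (u.count true : ℤ) - v.count true ≥ 2 := by omega
  have hq : 0 < q := by linarith
  nlinarith

theorem LowW.cyc {o p w} (h : LowW o p w) : CycBalanced w := by
  apply cyc_of ((o:ℤ) + p) p (-p)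
  intro u v huv
  have key : ((u.count false : ℤ) - 1) * p ≤ o * u.count true ∧
    (o : ℤ) * (u.count true - 1) < u.count false * p := by
    rcases pref_double huv with ⟨v', hv⟩ | ⟨u', rfl, hu⟩
    · exact h.pr u v' hv
    · have := h.pr u' v hu
      simp only [List.count_append, h.cf, h.ct]
      push_cast
      constructor <;> nlinarith [this.1, this.2]
  rw [len_counts u]; push_cast
  constructor <;> nlinarith [key.1, key.2]

theorem UpW.cyc {o p w} (h : UpW o p w) : CycBalanced w := by
  apply cyc_of ((o:ℤ) + p) p (-p+1)
  intro u v huv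
  have key : (o : ℤ) * (u.count true - 1) ≤ u.count false * p ∧
    ((u.count false : ℤ) - 1) * p < o * u.count true := by
    rcases pref_double huv with ⟨v', hv⟩ | ⟨u', rfl, hu⟩
    · exact h.pr u v' hv
    · have := h.pr u' v hu
      simp only [List.count_append, h.cf, h.ct]
      push_cast
      constructor <;> nlinarith [this.1, this.2]
  rw [len_counts u]; push_cast
  constructor <;> nlinarith [key.1, key.2]

/-! averaging -/

theorem preW_add (x : ℕ → Bool) (i l : ℕ) : preW x (i + l) = preW x i ++ preW (shft^[i] x) l := by
  induction i generalizing x with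
  | zero => simp [preW]
  | succ i ih =>
    rw [show i + 1 + l = (i + l) + 1 by omega, preW_succ, preW_succ, ih]; rfl

theorem per_shift (v : List Bool) : shft^[v.length] (per v) = per v := by
  funext k
  rw [shft_iter_apply]; simp [per]

theorem per_shift_mod (v : List Bool) (i : ℕ) : shft^[i] (per v) = shft^[i % v.length] (per v) := by
  funext k
  rw [shft_iter_apply, shft_iter_apply]; simp [per]

theorem preW_per (v : List Bool) : preW (per v) v.length = v := by
  apply List.ext_getElem
  · simp
  · intro i h1 h2
    simp [preW, per, Nat.mod_eq_of_lt h2, List.getElem?_eq_getElem h2]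

theorem preW_per2 (v : List Bool) : preW (per v) (v.length + v.length) = v ++ v := by
  rw [preW_add, per_shift, preW_per]

theorem count_blocks (x : ℕ → Bool) (m l : ℕ) : (preW x (m * l)).count true =
    ∑ j ∈ Finset.range m, (preW (shft^[j * l] x) l).count true := by
  induction m with
  | zero => simp [preW]
  | succ m ih => rw [Nat.succ_mul, preW_add, List.count_append, ih, Finset.sum_range_succ]

theorem count_period (v : List Bool) (i : ℕ) :
    (preW (shft^[i] (per v)) v.length).count true = v.count true := by
  have h1 := congrArg (List.count true) (preW_add (per v) i v.length)
  have h2 := congrArg (List.count true) (preW_add (per v) v.length i)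
  rw [per_shift, preW_per] at h2
  rw [add_comm i, h2] at h1
  simp only [List.count_append] at h1
  omega

theorem count_bal {v : List Bool} (hv : CycBalanced v) (hq : 0 < v.length) {l : ℕ}
    (hl : l ≤ v.length) (i j : ℕ) :
    ((preW (shft^[i] (per v)) l).count true : ℤ) - (preW (shft^[j] (per v)) l).count true ≤ 1 := by
  have hin : ∀ i, preW (shft^[i] (per v)) l <:+: v ++ v := by
    intro i
    rw [per_shift_mod, ← preW_per2]
    have := Nat.mod_lt i hq
    have h1 : v.length + v.length = i % v.length + (l + (v.length + v.length - (i % v.length + l))) := by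
      omega
    rw [h1, preW_add, preW_add]
    exact ⟨_, _, by rw [List.append_assoc]⟩
  exact hv _ _ (hin i) (hin j) (by simp)

theorem sum_blocks (v : List Bool) (l i : ℕ) :
    ∑ j ∈ Finset.range v.length, (preW (shft^[j * l + i] (per v)) l).count true =
      l * v.count true := by
  have h1 := count_blocks (shft^[i] (per v)) v.length l
  have h2 := count_blocks (shft^[i] (per v)) l v.length
  rw [mul_comm, h2] at h1
  simp only [← Function.iterate_add_apply, count_period] at h1
  simpa using h1.symm

theorem avg_upper {v : List Bool} (hv : CycBalanced v) (hq : 0 < v.length) {l : ℕ}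
    (hl : l ≤ v.length) (i : ℕ) :
    (v.length : ℤ) * (preW (shft^[i] (per v)) l).count true < l * v.count true + v.length := by
  have h1 := sum_blocks v l i
  have h2 : (0:ℤ) < ∑ j ∈ Finset.range v.length,
      (((preW (shft^[j * l + i] (per v)) l).count true : ℤ) -
        ((preW (shft^[i] (per v)) l).count true - 1)) := by
    apply Finset.sum_pos'
    · intro j _
      have := count_bal hv hq hl i (j * l + i)
      linarith
    · exact ⟨0, by simpa using hq, by simp⟩
  rw [Finset.sum_sub_distrib] at h2
  have h3 : (∑ j ∈ Finset.range v.length, ((preW (shft^[j * l + i] (per v)) l).count true : ℤ)) =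
      l * v.count true := by exact_mod_cast h1
  rw [h3] at h2
  simp at h2
  linarith

theorem avg_lower {v : List Bool} (hv : CycBalanced v) (hq : 0 < v.length) {l : ℕ}
    (hl : l ≤ v.length) (i : ℕ) :
    (l : ℤ) * v.count true < v.length * (preW (shft^[i] (per v)) l).count true + v.length := by
  have h1 := sum_blocks v l i
  have h2 : (0:ℤ) < ∑ j ∈ Finset.range v.length,
      (((preW (shft^[i] (per v)) l).count true + 1) -
      ((preW (shft^[j * l + i] (per v)) l).count true : ℤ)) := by
    apply Finset.sum_pos'
    · intro j _
      have := count_bal hv hq hl (j * l + i) i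
      linarith
    · exact ⟨0, by simpa using hq, by simp⟩
  rw [Finset.sum_sub_distrib] at h2
  have h3 : (∑ j ∈ Finset.range v.length, ((preW (shft^[j * l + i] (per v)) l).count true : ℤ)) =
      l * v.count true := by exact_mod_cast h1
  rw [h3] at h2
  simp at h2
  linarith

theorem pref_block {b : Bool} {u v' : List Bool} :
    u = preW (shft^[1] (per (b :: (u ++ v')))) u.length := by
  have h := preW_per (b :: (u ++ v'))
  have h2 : (b :: (u ++ v')).length = 1 + (u.length + v'.length) := by simp; omega
  rw [h2, preW_add, preW_add, ] at h
  have h3 : preW (per (b :: (u ++ v'))) 1 = [b] := by simp [preW, per]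
  rw [h3] at h
  simp only [List.cons_append, List.nil_append, List.cons.injEq, true_and] at h
  exact (List.append_inj_left h (by simp)).symm

theorem lex_split {w v : List Bool} (h : List.Lex (· < ·) w v) (hl : w.length = v.length) :
    ∃ a b c, w = a ++ false :: b ∧ v = a ++ true :: c := by
  induction h with
  | nil => simp at hl
  | cons h ih =>
    obtain ⟨a, b, c, h1, h2⟩ := ih (by simpa using hl)
    exact ⟨_ :: a, b, c, by rw [h1]; rfl, by rw [h2]; rfl⟩
  | rel h =>
    rw [Bool.lt_iff] at h
    exact ⟨[], _, _, by rw [h.1]; rfl, by rw [h.2]; rfl⟩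

theorem lex_tri (w v : List Bool) : v = w ∨ List.Lex (· < ·) v w ∨ List.Lex (· < ·) w v := by
  rcases lt_trichotomy v w with h | h | h
  · exact Or.inr (Or.inl h)
  · exact Or.inl h
  · exact Or.inr (Or.inr h)

theorem lex_asymm (w v : List Bool) (h : List.Lex (· < ·) v w) (h' : List.Lex (· < ·) w v) : False :=
  lt_asymm (a := v) (b := w) h h'

theorem low_isOmega {r : ℚ} {o p : ℕ} {w : List Bool} (hp : 0 < p) (ho : 0 < o)
    (hden : r.den = o + p) (hnum : r.num.toNat = p) (h : LowW o p w) : IsOmegaMinus r w := by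
  have hlen : w.length = o + p := by rw [len_counts, h.cf, h.ct]
  refine ⟨⟨by rw [hlen, hden], by rw [h.ct, hnum], h.cyc, ?_⟩, ?_⟩
  · rcases w with _ | ⟨b, w⟩
    · simp at hlen; omega
    · cases b
      · rfl
      · have := (h.pr [true] w rfl).2
        simp at this
  · rintro v ⟨v1, v2, v3, v4⟩
    rcases lex_tri w v with h1 | h1 | h1
    · exact Or.inl h1
    · exact Or.inr h1
    · exfalso
      obtain ⟨a, b, c, rfl, rfl⟩ := lex_split h1 (by rw [hlen, v1, hden])
      rcases a with _ | ⟨d, a⟩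
      · simp at v4
      · have h2 := (h.pr (d :: a ++ [false]) b (by simp)).1
        simp at v4
        subst v4
        have e : (false :: a ++ true :: c) = false :: ((a ++ [true]) ++ c) := by simp
        rw [e] at v1 v2 v3
        have h3 := avg_upper v3 (by simp) (l := (a ++ [true]).length) (by simp) 1
        rw [← pref_block, v1, v2, hden, hnum] at h3
        have hL : (a.length : ℤ) = a.count false + a.count true := by
          exact_mod_cast len_counts a
        simp [-List.count_false_add_count_true, -List.count_true_add_count_false, hL] at h2 h3
        nlinarith

theorem up_isOmega {r : ℚ} {o p : ℕ} {w : List Bool} (hp : 0 < p) (ho : 0 < o)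
    (hden : r.den = o + p) (hnum : r.num.toNat = p) (h : UpW o p w) : IsOmegaPlus r w := by
  have hlen : w.length = o + p := by rw [len_counts, h.cf, h.ct]
  refine ⟨⟨by rw [hlen, hden], by rw [h.ct, hnum], h.cyc, ?_⟩, ?_⟩
  · rcases w with _ | ⟨b, w⟩
    · simp at hlen; omega
    · cases b
      · have := (h.pr [false] w rfl).2
        simp at this
      · rfl
  · rintro v ⟨v1, v2, v3, v4⟩
    rcases lex_tri w v with h1 | h1 | h1
    · exact Or.inl h1
    · exfalso
      obtain ⟨a, b, c, rfl, rfl⟩ := lex_split h1 (by rw [hlen, v1, hden])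
      rcases a with _ | ⟨d, a⟩
      · simp at v4
      · have h2 := (h.pr (d :: a ++ [true]) c (by simp)).1
        simp at v4
        subst v4
        have e : (true :: a ++ false :: b) = true :: ((a ++ [false]) ++ b) := by simp
        rw [e] at v1 v2 v3
        have h3 := avg_lower v3 (by simp) (l := (a ++ [false]).length) (by simp) 1
        rw [← pref_block, v1, v2, hden, hnum] at h3
        have hL : (a.length : ℤ) = a.count false + a.count true := by
          exact_mod_cast len_counts a
        simp [-List.count_false_add_count_true, -List.count_true_add_count_false, hL] at h2 h3
        nlinarith
    · exact Or.inr h1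

theorem omegaMinus_eq {r : ℚ} {w} (h : IsOmegaMinus r w) : omegaMinus r = w := by
  have hex : ∃ w, IsOmegaMinus r w := ⟨w, h⟩
  have h2 := hex.choose_spec
  rw [omegaMinus, dif_pos hex]
  rcases h.2 _ h2.1 with h3 | h3
  · exact h3
  · rcases h2.2 _ h.1 with h4 | h4
    · exact h4.symm
    · exact (lex_asymm _ _ h3 h4).elim

theorem omegaPlus_eq {r : ℚ} {w} (h : IsOmegaPlus r w) : omegaPlus r = w := by
  have hex : ∃ w, IsOmegaPlus r w := ⟨w, h⟩
  have h2 := hex.choose_spec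
  rw [omegaPlus, dif_pos hex]
  rcases h.2 _ h2.1 with h3 | h3
  · exact h3
  · rcases h2.2 _ h.1 with h4 | h4
    · exact h4.symm
    · exact (lex_asymm _ _ h3 h4).elim

def fR (r : ℚ) (b : Bool) : List Bool := if b then omegaPlus r else omegaMinus r

theorem dec_fR {r : ℚ} (h0 : 0 < r) (h1 : r < 1) : Dec (fR r) := by
  have hn : 0 < r.num := Rat.num_pos.2 h0
  have hlt : r.num < r.den := by
    have := Rat.lt_iff r 1
    simp at this
    exact this.1 h1
  obtain ⟨p, hp⟩ := Int.eq_ofNat_of_zero_le hn.le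
  have hden : r.den = (r.den - p) + p := by omega
  have hc := r.reduced
  obtain ⟨f, hf, hl, hu⟩ := dec_exists _ (r.den - p) p le_rfl (by omega) (by omega) (by
    have h2 : Nat.Coprime p r.den := by simpa [hp] using hc
    rw [hden] at h2
    have := (Nat.coprime_add_self_right).1 h2
    exact this.symm)
  have e1 := omegaMinus_eq (low_isOmega (by omega) (by omega) hden (by rw [hp]; simp) hl)
  have e2 := omegaPlus_eq (up_isOmega (by omega) (by omega) hden (by rw [hp]; simp) hu)
  have : fR r = f := by
    funext b; cases b <;> simp [fR, e1, e2]
  rw [this]; exact hf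

/-! ### Assembling the proof -/

structure Good (f : Bool → List Bool) : Prop where
  f0 : ∃ w, f false = false :: true :: w
  f1 : ∃ w, f true = true :: false :: w
  cnt : ∀ s u, s 0 = false → u 0 = true → (Sv s u).Countable →
    (Sv (infS f s) (infS f u)).Countable
  lo : Lo f

theorem Good.hp {f} (h : Good f) : HP f := by
  intro b
  obtain ⟨w, hw⟩ := h.f0
  obtain ⟨v, hv⟩ := h.f1
  cases b
  · exact ⟨_, hw⟩
  · exact ⟨_, hv⟩

theorem Good.len {f} (h : Good f) (b) : 2 ≤ (f b).length := by
  obtain ⟨w, hw⟩ := h.f0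
  obtain ⟨v, hv⟩ := h.f1
  cases b <;> simp [hw, hv]

theorem Good.i0 {f} (h : Good f) (x) : ∃ y, infS f (cns false x) = cns false (cns true y) := by
  obtain ⟨w, hw⟩ := h.f0
  rw [infS_rec h.hp.len]
  exact ⟨_, by simp [hw]; rfl⟩

theorem Good.i1 {f} (h : Good f) (x) : ∃ y, infS f (cns true x) = cns true (cns false y) := by
  obtain ⟨w, hw⟩ := h.f1
  rw [infS_rec h.hp.len]
  exact ⟨_, by simp [hw]; rfl⟩

theorem good_comp {f g} (h : Good f) (hg : HP g) (hu : Up g) (hl : Lo g)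
    (h0 : ∀ w, ∃ v, homW g (false :: true :: w) = false :: true :: v)
    (h1 : ∀ w, ∃ v, homW g (true :: false :: w) = true :: false :: v) :
    Good (fun b => homW g (f b)) := by
  refine ⟨?_, ?_, ?_, ?_⟩
  · obtain ⟨w, hw⟩ := h.f0
    rw [hw]; exact h0 w
  · obtain ⟨w, hw⟩ := h.f1
    rw [hw]; exact h1 w
  · intro s u hs hu0 hc
    rw [infS_comp h.hp.len hg.len, infS_comp h.hp.len hg.len]
    exact up_step hg hu (by rw [infS_head h.hp, hs]) (by rw [infS_head h.hp, hu0]) (h.cnt s u hs hu0 hc)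
  · intro s u x hx
    rw [infS_comp h.hp.len hg.len, infS_comp h.hp.len hg.len, infS_comp h.hp.len hg.len]
    have := h.lo s u x hx
    obtain ⟨s', hs'⟩ := h.i0 (cns true s)
    obtain ⟨u', hu'⟩ := h.i1 (cns false u)
    rw [hs', hu'] at this ⊢
    exact hl _ _ _ this

theorem Dec.good {f} (h : Dec f) : Good f := by
  induction h with
  | M => exact ⟨⟨[], rfl⟩, ⟨[], rfl⟩, fun s u hs hu hc => up_step hpM upM hs hu hc, loM⟩
  | A f _ ih =>
    exact good_comp ih hpA upA loA (fun w => ⟨_, by simp [fA]; rfl⟩) (fun w => ⟨_, by simp [fA]; rfl⟩)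
  | B f _ ih =>
    exact good_comp ih hpB upB loB (fun w => ⟨_, by simp [fB]; rfl⟩) (fun w => ⟨_, by simp [fB]; rfl⟩)

def RR (r : ℕ → ℚ) : Prop := ∀ i, 0 < r i ∧ r i < 1

def rs (r : ℕ → ℚ) : ℕ → ℚ := fun i => r (i+1)

theorem RR.rs {r} (h : RR r) : RR (rs r) := fun i => h (i+1)
theorem RR.good {r} (h : RR r) : Good (fR (r 0)) := (dec_fR (h 0).1 (h 0).2).good

def WW (b : Bool) : (ℕ → ℚ) → ℕ → List Bool
  | _, 0 => [b]
  | r, n+1 => homW (fR (r 0)) (WW b (rs r) n)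

theorem sWordN_eq (r : ℕ → ℚ) (n : ℕ) : sWordN r n = WW false r n := by
  induction n generalizing r with
  | zero => rfl
  | succ n ih =>
    have := ih (rs r)
    simp only [sWordN, rs] at this
    simp only [sWordN, List.ofFn_succ, sWord, WW, Fin.val_zero, Fin.val_succ, this]
    rw [substR, homW, List.flatMap_def]
    rfl

theorem tWordN_eq (r : ℕ → ℚ) (n : ℕ) : tWordN r n = WW true r n := by
  induction n generalizing r with
  | zero => rfl
  | succ n ih =>
    have := ih (rs r)
    simp only [tWordN, rs] at this
    simp only [tWordN, List.ofFn_succ, tWord, WW, Fin.val_zero, Fin.val_succ, this]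
    rw [substR, homW, List.flatMap_def]
    rfl

def lim (b : Bool) (r : ℕ → ℚ) : ℕ → Bool := fun k => (WW b r (k+1)).getD k false

theorem sLim_eq (r) : sLim r = lim false r := by funext k; simp only [sLim, lim, sWordN_eq]
theorem tLim_eq (r) : tLim r = lim true r := by funext k; simp only [tLim, lim, tWordN_eq]

theorem WW_len {b r} (h : RR r) (n) : n < (WW b r n).length := by
  induction n generalizing r with
  | zero => simp [WW]
  | succ n ih =>
    have h1 := ih h.rs
    have h2 := homW_length h.good.len (WW b (rs r) n)
    simp only [WW]; omega

theorem WW_isPre {b r} (h : RR r) (n) : WW b r n <+: WW b r (n+1) := by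
  induction n generalizing r with
  | zero =>
    obtain ⟨w, hw⟩ := h.good.hp b
    simp [WW, hw]
  | succ n ih => exact homW_isPre _ (ih h.rs)

theorem WW_isPreLe {b r} (h : RR r) {n m} (hnm : n ≤ m) : WW b r n <+: WW b r m := by
  induction hnm with
  | refl => exact List.prefix_refl _
  | step _ ih => exact ih.trans (WW_isPre h _)

theorem lim_get {b r} (h : RR r) {n k} (hk : k < (WW b r n).length) :
    lim b r k = (WW b r n).getD k false := by
  have h1 : k < (WW b r (k+1)).length := (Nat.lt_succ_self k).trans (WW_len h (k+1))
  rcases le_total n (k+1) with h2 | h2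
  · exact getD_isPre (WW_isPreLe h h2) hk
  · exact (getD_isPre (WW_isPreLe h h2) h1).symm

theorem preW_lim {b r} (h : RR r) (n) : preW (lim b r) (WW b r n).length = WW b r n := by
  apply List.ext_getElem
  · simp
  · intro i h1 h2
    have := lim_get h h2
    simp [preW, this, List.getElem?_eq_getElem h2]

theorem lim_rec {b r} (h : RR r) : lim b r = infS (fR (r 0)) (lim b (rs r)) := by
  funext k
  have h1 : k < (WW b r (k+1)).length := (Nat.lt_succ_self k).trans (WW_len h (k+1))
  have h2 := preW_lim (b := b) h.rs k
  have h3 := infS_eq h.good.hp.len (lim b (rs r)) (k := k) (n := (WW b (rs r) k).length)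
    (by rw [h2]; exact h1)
  rw [h3, h2]; rfl

theorem lim_zero {b r} (h : RR r) : lim b r 0 = b := by
  rw [lim_get h (n := 0) (by simp [WW])]; rfl

theorem lim_form0 {r} (h : RR r) : ∃ y, lim false r = cns false (cns true y) := by
  rw [lim_rec h, ← cns_eta (lim false (rs r)), lim_zero h.rs]
  exact h.good.i0 _

theorem cat_len (w : List Bool) (x : ℕ → Bool) (j : ℕ) : cat w x (w.length + j) = x j := by
  simp [cat]

theorem lim_form {r} (h : RR r) : ∃ y j k, lim false r = cns false (cns true y) ∧ y j = true ∧
    y k = false := by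
  obtain ⟨y, hy⟩ := lim_form0 h.rs
  obtain ⟨w, hw⟩ := h.good.f0
  obtain ⟨v, hv⟩ := h.good.f1
  refine ⟨cat w (infS (fR (r 0)) (cns true y)), w.length + 0, w.length + 1, ?_, ?_, ?_⟩
  · rw [lim_rec h, hy, infS_rec h.good.hp.len]
    simp [hw]
  · rw [cat_len, infS_head h.good.hp]; rfl
  · obtain ⟨z, hz⟩ := h.good.i1 y
    rw [cat_len, hz]; rfl

def itS : (ℕ → ℚ) → ℕ → (ℕ → Bool) → (ℕ → Bool)
  | _, 0, x => x
  | r, n+1, x => infS (fR (r 0)) (itS (rs r) n x)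

theorem it_head {r} (h : RR r) (n x) : itS r n x 0 = x 0 := by
  induction n generalizing r with
  | zero => rfl
  | succ n ih => simp only [itS]; rw [infS_head h.good.hp, ih h.rs]

theorem infS_agree {f} (h : Good f) {n} {x y : ℕ → Bool} (hxy : ∀ i < n + 1, x i = y i) :
    ∀ i < n + 2, infS f x i = infS f y i := by
  intro i hi
  have e : preW x (n+1) = preW y (n+1) := by
    apply List.map_congr_left
    intro a ha
    exact hxy a (List.mem_range.1 ha)
  have h2 := homW_length h.len (preW y (n+1))
  rw [preW_length] at h2
  rw [infS_eq h.hp.len x (n := n+1) (by rw [e]; omega), infS_eq h.hp.len y (n := n+1) (by omega), e]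

theorem it_agree {r} (h : RR r) (n) {x y : ℕ → Bool} (hxy : x 0 = y 0) :
    ∀ i < n + 1, itS r n x i = itS r n y i := by
  induction n generalizing r with
  | zero =>
    intro i hi
    obtain rfl : i = 0 := by omega
    exact hxy
  | succ n ih => exact infS_agree h.good (ih h.rs)

theorem lim_it {b r} (h : RR r) (n) : ∃ r', RR r' ∧ lim b r = itS r n (lim b r') := by
  induction n generalizing r with
  | zero => exact ⟨r, h, rfl⟩
  | succ n ih =>
    obtain ⟨r', h1, h2⟩ := ih h.rs
    exact ⟨r', h1, by rw [lim_rec h, h2]; rfl⟩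

theorem it_close {r} (h : RR r) (n) {x : ℕ → Bool} (hx : x 0 = true) :
    |piMap (itS r n x) - piMap (lim true r)| ≤ 1 / 2 ^ n := by
  obtain ⟨r', h1, h2⟩ := lim_it (b := true) h n
  rw [h2]
  apply pi_close
  intro i hi
  exact it_agree h n (by rw [hx, lim_zero h1]) i (by omega)

theorem Sv_base {s} (hs : s 0 = false) : (Sv s c1).Countable := by
  refine (Set.countable_singleton c0).mono ?_
  intro x hx
  funext k
  by_contra hk
  have hk : x k = true := by simpa [c0] using hk
  refine hx k ⟨⟨0, by simp, ?_⟩, le_c1 _⟩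
  show s 0 < (shft^[k] x) 0
  rw [shft_iter_apply, hs, Nat.add_zero, hk]; decide

theorem it_up {r} (h : RR r) (n) : (Sv (lim false r) (itS r n c1)).Countable := by
  induction n generalizing r with
  | zero => exact Sv_base (lim_zero h)
  | succ n ih =>
    rw [lim_rec h]
    exact h.good.cnt _ _ (lim_zero h.rs) (by rw [it_head h.rs]; rfl) (ih h.rs)

theorem it_form {r} (h : RR r) (n) : ∃ y, itS r n (cns true (cns false c0)) = cns true (cns false y) := by
  cases n with
  | zero => exact ⟨_, rfl⟩
  | succ n =>
    simp only [itS]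
    rw [← cns_eta (itS (rs r) n _), it_head h.rs]
    exact h.good.i1 _

theorem it_lo {r} (h : RR r) (n) :
    ¬ {x | KK (lim false r) (itS r n (cns true (cns false c0))) x}.Countable := by
  induction n generalizing r with
  | zero =>
    obtain ⟨y, j, k, h1, h2, -⟩ := lim_form h
    rw [h1]
    exact KK_base y j h2
  | succ n ih =>
    intro hc
    apply ih h.rs
    refine (hc.preimage (infS_inj h.good.hp)).mono ?_
    intro x hx
    obtain ⟨y, hy⟩ := lim_form0 h.rs
    obtain ⟨z, hz⟩ := it_form h.rs n
    simp only [Set.mem_setOf_eq, Set.mem_preimage] at hx ⊢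
    rw [lim_rec h]
    simp only [itS]
    rw [hy, hz] at hx ⊢
    exact h.good.lo _ _ _ hx

theorem pi_lt_one {x : ℕ → Bool} {k : ℕ} (h : x k = false) : piMap x < 1 := by
  induction k generalizing x with
  | zero =>
    have := pi_le_one (shft x)
    rw [← cns_eta x, pi_cns, h]; simp; linarith
  | succ k ih =>
    have := ih (x := shft x) h
    rw [← cns_eta x, pi_cns]
    split_ifs <;> linarith

theorem pow_small {e : ℝ} (he : 0 < e) : ∃ n : ℕ, 1 / (2:ℝ) ^ n < e := by
  obtain ⟨n, hn⟩ := exists_pow_lt_of_lt_one he (by norm_num : (1/2 : ℝ) < 1)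
  exact ⟨n, by rwa [one_div_pow] at hn⟩

theorem chi_lub {r} (h : RR r) :
    IsLUB {b | b ∈ Set.Ioo (piMap (lim false r)) 1 ∧ ¬ (J (piMap (lim false r)) b).Countable}
      (piMap (lim true r)) := by
  have mem : ∀ n, piMap (itS r n (cns true (cns false c0))) ∈
      {b | b ∈ Set.Ioo (piMap (lim false r)) 1 ∧ ¬ (J (piMap (lim false r)) b).Countable} := by
    intro n
    refine ⟨?_, J_uncountable (it_lo h n)⟩
    obtain ⟨y, j, k, h1, h2, h3⟩ := lim_form h
    obtain ⟨z, hz⟩ := it_form h n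
    have := pi_lt_one h3
    have := pi_nonneg z
    have := pi_le_one z
    rw [h1, hz]
    simp only [pi_cns]
    constructor <;> simp <;> linarith
  constructor
  · rintro b ⟨hb, hJ⟩
    by_contra hlt
    push Not at hlt
    obtain ⟨n, hn⟩ := pow_small (sub_pos.2 hlt)
    have h1 := (abs_le.1 (it_close h n (x := c1) rfl)).2
    exact hJ (J_countable (by linarith) (it_up h n))
  · intro c hc
    by_contra hlt
    push Not at hlt
    obtain ⟨n, hn⟩ := pow_small (sub_pos.2 hlt)
    have h1 := (abs_le.1 (it_close h n (x := cns true (cns false c0)) rfl)).1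
    have h2 := hc (mem n)
    linarith

theorem chi_main {r} (h : RR r) : chi (piMap (lim false r)) = piMap (lim true r) := by
  have hl := chi_lub h
  refine hl.csSup_eq ?_
  by_contra hne
  rw [Set.not_nonempty_iff_eq_empty] at hne
  rw [hne] at hl
  have := hl.2 (show piMap (lim true r) - 1 ∈ upperBounds (∅ : Set ℝ) by simp)
  linarith

theorem stmt12 (r : ℕ → ℚ) (hr : ∀ i, 0 < r i ∧ r i < 1) :
    chi (piMap (sLim r)) = piMap (tLim r) := by
  rw [sLim_eq, tLim_eq]
  exact chi_main hr

end
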